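/- Let W be a finite Weyl group of simply-laced type with simple reflections indexed by I, and let I = I₀ ⊔ I₁ be a 2-coloring of the Dynkin diagram (every edge has one endpoint in I₀ and one in I₁). Set c₀ = ∏_{i∈I₀} s_i and c₁ = ∏_{i∈I₁} s_i (the products are well-defined since the factors commute). If the Coxeter number h is even, then w₀ = (c₀c₁)^{h/2} is a reduced expression for the longest element w₀ of W; in particular ℓ(w₀) = (h/2)·ℓ(c₀c₁) = (h/2)·|I|. -/

import Mathlib

/-- The alternating product `a * b * a * ⋯` with `k` factors. -/
def altProd {W : Type*} [Monoid W] (a b : W) : ℕ → W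
  | 0 => 1
  | k + 1 => altProd a b k * if Even k then a else b

theorem altProd_succ' {W : Type*} [Monoid W] (a b : W) (k : ℕ) :
    altProd a b (k + 1) = a * altProd b a k := by
  induction k with
  | zero => simp [altProd]
  | succ k ih =>
    rw [altProd, ih, altProd, mul_assoc]
    by_cases hk : Even k <;> simp [hk, Nat.even_add_one]

theorem altProd_two_mul {W : Type*} [Monoid W] (a b : W) (k : ℕ) :
    altProd a b (2 * k) = (a * b) ^ k := by
  induction k with
  | zero => simp [altProd]
  | succ k ih => simp [mul_add, altProd, ih, pow_succ, mul_assoc]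

/-- The alternating sum `m + n + m + ⋯` with `k` terms. -/
def altSum (m n : ℕ) : ℕ → ℕ
  | 0 => 0
  | k + 1 => altSum m n k + if Even k then m else n

theorem altSum_succ' (m n k : ℕ) : altSum m n (k + 1) = m + altSum n m k := by
  induction k with
  | zero => simp [altSum]
  | succ k ih =>
    rw [altSum, ih, altSum, add_assoc]
    by_cases hk : Even k <;> simp [hk, Nat.even_add_one]

theorem altSum_two_mul (m n k : ℕ) : altSum m n (2 * k) = k * (m + n) := by
  induction k with
  | zero => simp [altSum]
  | succ k ih =>
    simp only [mul_add, altSum, ih]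
    simp
    ring

theorem le_altSum {m n : ℕ} (hm : 0 < m) (hn : 0 < n) (k : ℕ) : k ≤ altSum m n k := by
  induction k with
  | zero => simp
  | succ k ih => rw [altSum]; split_ifs <;> omega

/-- A length function on (part of) a group for which right multiplication by the involutions
`a` and `b` changes the length by exactly `m` and `n`, respectively, and for which `w₀` is the
only element whose length goes down under both. -/
structure IsAltLength {W : Type*} [Group W] (len : W → ℕ) (P : W → Prop) (a b w₀ : W)
    (m n : ℕ) : Prop where
  len_eq_zero {w} : len w = 0 ↔ w = 1
  one : P 1
  mul_left {w} : P w → P (w * a)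
  mul_right {w} : P w → P (w * b)
  left_sq : a * a = 1
  right_sq : b * b = 1
  len_left {w} : P w → len (w * a) = len w + m ∨ len w = len (w * a) + m
  len_right {w} : P w → len (w * b) = len w + n ∨ len w = len (w * b) + n
  eq_longest {w} : P w → len w = len (w * a) + m → len w = len (w * b) + n → w = w₀
  le_longest (w) : len w ≤ len w₀
  longest_sq : w₀ * w₀ = 1

namespace IsAltLength

variable {W : Type*} [Group W] {len : W → ℕ} {P : W → Prop} {a b w₀ : W} {m n : ℕ}

theorem len_one (H : IsAltLength len P a b w₀ m n) : len 1 = 0 := H.len_eq_zero.2 rfl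

theorem swap (H : IsAltLength len P a b w₀ m n) : IsAltLength len P b a w₀ n m where
  len_eq_zero := H.len_eq_zero
  one := H.one
  mul_left := H.mul_right
  mul_right := H.mul_left
  left_sq := H.right_sq
  right_sq := H.left_sq
  len_left := H.len_right
  len_right := H.len_left
  eq_longest h h₁ h₂ := H.eq_longest h h₂ h₁
  le_longest := H.le_longest
  longest_sq := H.longest_sq

theorem prop_altProd (H : IsAltLength len P a b w₀ m n) (k : ℕ) : P (altProd a b k) := by
  induction k with
  | zero => exact H.one
  | succ k ih =>
    rw [altProd]
    split_ifs
    exacts [H.mul_left ih, H.mul_right ih]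

theorem len_altProd (H : IsAltLength len P a b w₀ m n) (k : ℕ)
    (hk : ∀ j < k, altProd a b j ≠ w₀) : len (altProd a b k) = altSum m n k := by
  induction k using Nat.strong_induction_on with
  | _ k ih =>
    rcases k with _ | _ | k
    · exact H.len_one
    · have h1 := H.len_left H.one
      simp only [altProd, altSum, one_mul, H.len_one, Even.zero, if_true] at h1 ⊢
      omega
    · have hne := hk (k + 1) (Nat.lt_succ_self _)
      have hP := H.prop_altProd (k + 1)
      have hlk := ih (k + 1) (by omega) fun j hj => hk j (by omega)
      have hprev := ih k (by omega) fun j hj => hk j (by omega)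
      have hl := H.len_left hP
      have hr := H.len_right hP
      rw [altProd, altSum]
      by_cases he : Even k
      · have hback : altProd a b (k + 1) * a = altProd a b k := by
          simp [altProd, he, mul_assoc, H.left_sq]
        have hdesc : len (altProd a b (k + 1)) = len (altProd a b (k + 1) * a) + m := by
          rw [hback, hlk, hprev, altSum, if_pos he]
        simp only [Nat.even_add_one, he, not_true, if_false]
        rcases hr with hr | hr
        · rw [hr, hlk]
        · exact absurd (H.eq_longest hP hdesc hr) hne
      · have hback : altProd a b (k + 1) * b = altProd a b k := by
          simp [altProd, he, mul_assoc, H.right_sq]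
        have hdesc : len (altProd a b (k + 1)) = len (altProd a b (k + 1) * b) + n := by
          rw [hback, hlk, hprev, altSum, if_neg he]
        simp only [Nat.even_add_one, he, not_false_iff, if_true]
        rcases hl with hl | hl
        · rw [hl, hlk]
        · exact absurd (H.eq_longest hP hl hdesc) hne

theorem exists_first (H : IsAltLength len P a b w₀ m n) (hm : 0 < m) (hn : 0 < n) :
    ∃ K, altProd a b K = w₀ ∧ ∀ k ≤ K, len (altProd a b k) = altSum m n k := by
  classical
  have hex : ∃ K, altProd a b K = w₀ := by
    by_contra! hcon
    have h1 := H.len_altProd (len w₀ + 1) fun j _ => hcon j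
    have h2 := H.le_longest (altProd a b (len w₀ + 1))
    have h3 := le_altSum hm hn (len w₀ + 1)
    omega
  exact ⟨Nat.find hex, Nat.find_spec hex, fun k hk =>
    H.len_altProd k fun j hj => Nat.find_min hex (hj.trans_le hk)⟩

theorem first_le (H : IsAltLength len P a b w₀ m n) (hn : 0 < n) {K K' : ℕ}
    (hK : altProd a b K = w₀) (hlK : len (altProd a b K) = altSum m n K)
    (hlK' : ∀ k ≤ K', len (altProd b a k) = altSum n m k) : K' ≤ K := by
  by_contra! hlt
  have h1 := hlK' (K + 1) hlt
  rw [altSum_succ', ← hlK, hK] at h1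
  have h2 := H.le_longest (altProd b a (K + 1))
  omega

theorem longest_eq_pow_of_pos [Finite W] (H : IsAltLength len P a b w₀ m n) (hm : 0 < m)
    (hn : 0 < n) (he : Even (orderOf (a * b))) :
    w₀ = (a * b) ^ (orderOf (a * b) / 2) ∧ len w₀ = orderOf (a * b) / 2 * (m + n) := by
  obtain ⟨K, hK, hl⟩ := H.exists_first hm hn
  obtain ⟨K', hK', hl'⟩ := H.swap.exists_first hn hm
  obtain rfl : K' = K := le_antisymm (H.first_le hn hK (hl K le_rfl) hl')
    (H.swap.first_le hm hK' (hl' K' le_rfl) hl)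
  have hpos : 0 < orderOf (a * b) := orderOf_pos _
  obtain ⟨p, hp⟩ := he
  rcases Nat.even_or_odd' K' with ⟨q, rfl | rfl⟩
  · have hw : (a * b) ^ q = w₀ := by rw [← altProd_two_mul, hK]
    have hdvd : orderOf (a * b) ∣ q + q :=
      orderOf_dvd_of_pow_eq_one (by rw [pow_add, hw, H.longest_sq])
    obtain ⟨r, hr⟩ := hdvd
    have hr1 : r = 1 := by
      rcases r with _ | _ | r
      · have : q = 0 := by omega
        subst this
        have h1 := hl 0 le_rfl
        have h2 := H.le_longest a
        have h3 := H.len_left H.one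
        rw [pow_zero] at hw
        simp only [one_mul, ← hw, H.len_one] at h2 h3
        omega
      · rfl
      · have hle : 2 * orderOf (a * b) ≤ 2 * q := by nlinarith
        have h1 := hl _ hle
        rw [altProd_two_mul, pow_orderOf_eq_one, H.len_one, altSum_two_mul] at h1
        have := Nat.mul_pos hpos (Nat.add_pos_left hm n)
        omega
    have hq : orderOf (a * b) / 2 = q := by rw [hr1] at hr; omega
    rw [hq]
    exact ⟨hw.symm, by rw [← hw, ← altProd_two_mul, hl _ le_rfl, altSum_two_mul]⟩
  · exfalso
    have h1 : altProd a b (2 * q + 1) * altProd b a (2 * q + 1) = 1 := by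
      rw [hK, hK', H.longest_sq]
    have h2 : altProd a b (2 * q + 1) = (a * b) ^ q * a := by
      simp [altProd, altProd_two_mul]
    rw [altProd_succ' b a, h2, altProd_two_mul, mul_assoc, ← mul_assoc a, ← pow_succ',
      ← pow_add] at h1
    have := orderOf_dvd_of_pow_eq_one h1
    rw [hp] at this
    have : 2 ∣ q + (q + 1) := dvd_trans ⟨p, by ring⟩ this
    omega

theorem longest_eq_pow_of_eq_zero [Finite W] (H : IsAltLength len P a b w₀ 0 n)
    (he : Even (orderOf (a * b))) :
    w₀ = (a * b) ^ (orderOf (a * b) / 2) ∧ len w₀ = orderOf (a * b) / 2 * n := by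
  have ha := H.len_left H.one
  have hb := H.len_right H.one
  simp only [one_mul, H.len_one, add_zero, zero_add] at ha hb
  obtain rfl : a = 1 := H.len_eq_zero.1 (by omega)
  rw [one_mul] at he ⊢
  have hPb : P b := one_mul b ▸ H.mul_right H.one
  have hlen : len b = n := by omega
  have hw : b = w₀ := H.eq_longest hPb (by simp) (by rw [H.right_sq, H.len_one, hlen, zero_add])
  have hord : orderOf b = 2 := by
    have h1 := Nat.le_of_dvd two_pos
      (orderOf_dvd_of_pow_eq_one (by rw [pow_two, H.right_sq] : b ^ 2 = 1))
    have h2 := orderOf_pos b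
    obtain ⟨r, hr⟩ := he
    omega
  rw [← hw, hord, hlen]
  simp

theorem longest_eq_pow [Finite W] (H : IsAltLength len P a b w₀ m n)
    (he : Even (orderOf (a * b))) :
    w₀ = (a * b) ^ (orderOf (a * b) / 2) ∧ len w₀ = orderOf (a * b) / 2 * (m + n) := by
  rcases m.eq_zero_or_pos with rfl | hm
  · simpa using H.longest_eq_pow_of_eq_zero he
  rcases n.eq_zero_or_pos with rfl | hn
  · have hb := H.len_right H.one
    simp only [one_mul, H.len_one, add_zero] at hb
    obtain rfl : b = 1 := H.len_eq_zero.1 (by omega)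
    simpa using H.swap.longest_eq_pow_of_eq_zero (by simpa using he)
  exact H.longest_eq_pow_of_pos hm hn he

end IsAltLength

open Matrix in
/-- An irreducible symmetric matrix with nonnegative entries has a positive eigenvector. -/
theorem Matrix.exists_pos_eigenvector {I : Type*} [Fintype I] [DecidableEq I]
    (A : Matrix I I ℝ) (hsymm : ∀ i j, A i j = A j i) (hnn : ∀ i j, 0 ≤ A i j)
    (hconn : ∀ s : Set I, s.Nonempty → (∀ i ∈ s, ∀ j, A i j ≠ 0 → j ∈ s) → s = Set.univ) :
    ∃ (a : I → ℝ) (μ : ℝ), (∀ i, 0 < a i) ∧ A *ᵥ a = μ • a := by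
  rcases isEmpty_or_nonempty I with hI | hI
  · exact ⟨0, 0, isEmptyElim, Subsingleton.elim _ _⟩
  let T := Matrix.toEuclideanCLM (n := I) (𝕜 := ℝ) A
  have hTapp (x : EuclideanSpace ℝ I) (i : I) : T x i = ∑ j, A i j * x j := by
    simp [T, Matrix.ofLp_toEuclideanCLM, Matrix.mulVec, dotProduct]
  have hT : IsSelfAdjoint T := by
    have hA : IsSelfAdjoint A := by
      change Aᴴ = A
      ext i j
      simp [hsymm i j]
    exact hA.map _
  have hq (x : EuclideanSpace ℝ I) : T.reApplyInnerSelf x = ∑ i, ∑ j, A i j * (x j * x i) := by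
    simp [ContinuousLinearMap.reApplyInnerSelf_apply, PiLp.inner_apply, hTapp, Finset.mul_sum,
      mul_comm, mul_left_comm]
  obtain ⟨x, hxmem, hx⟩ := (isCompact_sphere (0 : EuclideanSpace ℝ I) 1).exists_isMaxOn
    (NormedSpace.sphere_nonempty.2 zero_le_one)
    (T.reApplyInnerSelf_continuous.continuousOn)
  have hxn : ‖x‖ = 1 := by simpa using hxmem
  let y : EuclideanSpace ℝ I := WithLp.toLp 2 fun i => |x i|
  have hyn : ‖y‖ = 1 := by
    rw [← hxn, EuclideanSpace.norm_eq, EuclideanSpace.norm_eq]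
    simp [y]
  have hy : IsMaxOn T.reApplyInnerSelf (Metric.sphere 0 ‖y‖) y := by
    intro z hz
    rw [hyn] at hz
    refine (show T.reApplyInnerSelf z ≤ T.reApplyInnerSelf x from hx hz).trans ?_
    rw [hq, hq]
    refine Finset.sum_le_sum fun i _ => Finset.sum_le_sum fun j _ => ?_
    refine mul_le_mul_of_nonneg_left ?_ (hnn i j)
    simpa [y, abs_mul] using le_abs_self (x j * x i)
  have hy0 : y ≠ 0 := by
    rintro h
    simp [h] at hyn
  have heig := (hT.hasEigenvector_of_isMaxOn hy0 hy).apply_eq_smul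
  set μ : ℝ := ⨆ x : { x : EuclideanSpace ℝ I // x ≠ 0 }, T.rayleighQuotient x
  have heig' (i : I) : ∑ j, A i j * y j = μ * y i := by
    rw [← hTapp]
    simpa using congrArg (fun v : EuclideanSpace ℝ I => v i) heig
  have hynn (i : I) : 0 ≤ y i := abs_nonneg _
  refine ⟨fun i => y i, μ, fun i => (hynn i).lt_of_ne' fun hi => hy0 ?_, ?_⟩
  · have huniv := hconn {i | y i = 0} ⟨i, hi⟩ fun i hi j hij => by
      have hi' : y i = 0 := hi
      have hz := heig' i
      rw [hi', mul_zero, Finset.sum_eq_zero_iff_of_nonneg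
        fun j _ => mul_nonneg (hnn i j) (hynn j)] at hz
      exact (mul_eq_zero.1 (hz j (Finset.mem_univ j))).resolve_left hij
    ext j
    exact (huniv ▸ Set.mem_univ j : j ∈ {i | y i = 0})
  · ext i
    simpa [Matrix.mulVec, dotProduct] using heig' i

theorem dotProduct_pos_of_pos {I : Type*} [Fintype I] {a v : I → ℝ} (ha : ∀ i, 0 < a i)
    (hv : 0 ≤ v) (hv0 : v ≠ 0) :
    0 < a ⬝ᵥ v := by
  obtain ⟨i, hi⟩ := Function.ne_iff.1 hv0
  exact Finset.sum_pos' (fun j _ => mul_nonneg (ha j).le (hv j))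
    ⟨i, Finset.mem_univ i, mul_pos (ha i) ((hv i).lt_of_ne' hi)⟩

namespace CoxeterMatrix

variable {I : Type*} (M : CoxeterMatrix I)

/-- The adjacency matrix of the graph whose edges are the pairs with `M i j = 3`. -/
noncomputable def adj : Matrix I I ℝ := fun i j => if M i j = 3 then 1 else 0

theorem adj_symm (i j : I) : M.adj i j = M.adj j i := by
  simp [adj, M.symmetric i j]

theorem adj_self (i : I) : M.adj i i = 0 := by
  simp [adj]

theorem pairwise_toList {J : Finset I} (hJ : ∀ i ∈ J, ∀ j ∈ J, i ≠ j → M i j = 2) :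
    J.toList.Pairwise fun i j => M i j = 2 :=
  J.nodup_toList.imp_of_mem fun hi hj hij =>
    hJ _ (Finset.mem_toList.1 hi) _ (Finset.mem_toList.1 hj) hij

/-- The Coxeter matrix has only the entries `2` and `3` off the diagonal. -/
def IsSimplyLaced : Prop := ∀ i j : I, i ≠ j → M i j = 2 ∨ M i j = 3

variable [Fintype I]

/-- The coroot functional attached to the vertex `i`. -/
noncomputable def coroot (i : I) : (I → ℝ) →ₗ[ℝ] ℝ :=
  (2 : ℝ) • LinearMap.proj i - ∑ j, M.adj i j • LinearMap.proj j

theorem coroot_apply (i : I) (v : I → ℝ) :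
    M.coroot i v = 2 * v i - ∑ j, M.adj i j * v j := by
  simp [coroot]

variable [DecidableEq I]

/-- The simple reflection attached to the vertex `i`. -/
noncomputable def refl (i : I) : Module.End ℝ (I → ℝ) :=
  LinearMap.id - (M.coroot i).smulRight (Pi.single i 1)

theorem refl_apply (i : I) (v : I → ℝ) :
    M.refl i v = v - M.coroot i v • Pi.single i 1 := by
  simp [refl]

theorem coroot_single (i j : I) :
    M.coroot i (Pi.single j 1) = 2 * (if i = j then 1 else 0) - M.adj i j := by
  simp [coroot_apply, Pi.single_apply]

theorem coroot_single_self (i : I) : M.coroot i (Pi.single i 1) = 2 := by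
  simp [coroot_single, adj_self]

theorem coroot_single_of_eq_two {i j : I} (hij : M i j = 2) :
    M.coroot i (Pi.single j 1) = 0 := by
  have : i ≠ j := by rintro rfl; simp at hij
  simp [coroot_single, adj, hij, this]

theorem coroot_single_of_eq_three {i j : I} (hij : M i j = 3) :
    M.coroot i (Pi.single j 1) = -1 := by
  have : i ≠ j := by rintro rfl; simp at hij
  simp [coroot_single, adj, hij, this]

variable {M}

theorem isLiftable_refl (hsl : M.IsSimplyLaced) : M.IsLiftable M.refl := by
  intro i j
  ext1 k
  ext1
  by_cases hij : i = j
  · subst hij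
    simp only [M.diagonal, pow_one, LinearMap.comp_apply, Module.End.mul_apply, refl_apply,
      map_sub, map_smul, coroot_single_self, Module.End.one_apply]
    module
  · rcases hsl i j hij with h | h <;> have h' := M.symmetric i j <;> rw [h, eq_comm] at h'
    · simp only [h, pow_succ, pow_zero, one_mul, LinearMap.comp_apply, Module.End.mul_apply,
        refl_apply, map_sub, map_smul, coroot_single_self, coroot_single_of_eq_two M h,
        coroot_single_of_eq_two M h', Module.End.one_apply]
      module
    · simp only [h, pow_succ, pow_zero, one_mul, LinearMap.comp_apply, Module.End.mul_apply,
        refl_apply, map_sub, map_smul, coroot_single_self, coroot_single_of_eq_three M h,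
        coroot_single_of_eq_three M h', Module.End.one_apply]
      module

end CoxeterMatrix

namespace CoxeterSystem

variable {I : Type*} {W : Type*} [Group W] {M : CoxeterMatrix I} (cs : CoxeterSystem M W)

theorem simple_mul_simple_comm {i j : I} (h : M i j = 2) :
    cs.simple i * cs.simple j = cs.simple j * cs.simple i := by
  have hp := cs.simple_mul_simple_pow i j
  rw [h, pow_two] at hp
  simpa using eq_inv_of_mul_eq_one_left hp

theorem simple_braid {i j : I} (h : M i j = 3) :
    cs.simple i * cs.simple j * cs.simple i = cs.simple j * cs.simple i * cs.simple j := by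
  have hp := cs.simple_mul_simple_pow i j
  rw [h, pow_succ, pow_two] at hp
  have hp' : cs.simple i * cs.simple j * cs.simple i *
      (cs.simple j * cs.simple i * cs.simple j) = 1 := by
    simpa only [mul_assoc] using hp
  simpa [mul_assoc] using eq_inv_of_mul_eq_one_left hp'

theorem isRightDescent_of_forall_length_le {w₀ : W}
    (hw₀ : ∀ w, cs.length w ≤ cs.length w₀) (i : I) : cs.IsRightDescent w₀ i := by
  by_contra h
  rw [not_isRightDescent_iff] at h
  have := hw₀ (w₀ * cs.simple i)
  omega

variable [DecidableEq I] [Fintype I] (hsl : M.IsSimplyLaced)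

/-- The geometric representation of a simply-laced Coxeter group. -/
noncomputable def geomRep : W →* Module.End ℝ (I → ℝ) :=
  cs.lift ⟨M.refl, CoxeterMatrix.isLiftable_refl hsl⟩

theorem geomRep_simple (i : I) : cs.geomRep hsl (cs.simple i) = M.refl i :=
  cs.lift_apply_simple (CoxeterMatrix.isLiftable_refl hsl) i

theorem geomRep_mul_simple (w : W) (i : I) (v : I → ℝ) :
    cs.geomRep hsl (w * cs.simple i) v =
      cs.geomRep hsl w v - M.coroot i v • cs.geomRep hsl w (Pi.single i 1) := by
  rw [map_mul, Module.End.mul_apply, geomRep_simple, M.refl_apply, map_sub, map_smul]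

theorem geomRep_mul_simple_self (w : W) (i : I) :
    cs.geomRep hsl (w * cs.simple i) (Pi.single i 1) = -cs.geomRep hsl w (Pi.single i 1) := by
  rw [geomRep_mul_simple, M.coroot_single_self]
  module

theorem geomRep_injective (w : W) : Function.Injective (cs.geomRep hsl w) := by
  refine Function.LeftInverse.injective (g := cs.geomRep hsl w⁻¹) fun v => ?_
  rw [← Module.End.mul_apply, ← map_mul, inv_mul_cancel, map_one, Module.End.one_apply]

theorem geomRep_single_ne_zero (w : W) (i : I) :
    cs.geomRep hsl w (Pi.single i 1) ≠ 0 := by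
  rw [Ne, ← map_zero (cs.geomRep hsl w), (cs.geomRep_injective hsl w).eq_iff]
  simp

/-- The root `w αᵢ` is positive if `w sᵢ` is longer than `w`. -/
theorem geomRep_single_nonneg {w : W} {i : I} (hw : ¬ cs.IsRightDescent w i) :
    0 ≤ cs.geomRep hsl w (Pi.single i 1) := by
  induction hn : cs.length w using Nat.strong_induction_on generalizing w i with
  | _ n ih =>
  subst hn
  by_cases hw1 : w = 1
  · simp [hw1]
  obtain ⟨j, hj⟩ := cs.exists_rightDescent_of_ne_one hw1
  have hij : j ≠ i := by rintro rfl; exact hw hj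
  have hvj := cs.isRightDescent_iff_not_isRightDescent_mul.1 hj
  rw [isRightDescent_iff] at hj
  rw [not_isRightDescent_iff] at hw
  obtain ⟨v, rfl⟩ : ∃ v, w = v * cs.simple j := ⟨w * cs.simple j, by simp⟩
  simp only [simple_mul_simple_cancel_right] at hj hvj
  rcases hsl j i hij with h | h
  · rw [geomRep_mul_simple, M.coroot_single_of_eq_two h, zero_smul, sub_zero]
    refine ih _ (by omega) (fun hd => ?_) rfl
    rw [isRightDescent_iff] at hd
    have hcomm : v * cs.simple j * cs.simple i = v * cs.simple i * cs.simple j := by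
      rw [mul_assoc, cs.simple_mul_simple_comm h, mul_assoc]
    rw [hcomm] at hw
    have := cs.length_mul_simple (v * cs.simple i) j
    omega
  · have hvj' := ih _ (by omega) hvj rfl
    have hroot : cs.geomRep hsl (v * cs.simple j) (Pi.single i 1) =
        cs.geomRep hsl v (Pi.single i 1) + cs.geomRep hsl v (Pi.single j 1) := by
      rw [geomRep_mul_simple, M.coroot_single_of_eq_three h]
      module
    rw [hroot]
    by_cases hvi : cs.IsRightDescent v i
    · obtain ⟨u, rfl⟩ : ∃ u, v = u * cs.simple i := ⟨v * cs.simple i, by simp⟩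
      rw [isRightDescent_iff] at hvi
      simp only [simple_mul_simple_cancel_right] at hvi
      have h' : M i j = 3 := by rw [M.symmetric, h]
      have hrw : cs.geomRep hsl (u * cs.simple i) (Pi.single i 1) +
          cs.geomRep hsl (u * cs.simple i) (Pi.single j 1) =
            cs.geomRep hsl u (Pi.single j 1) := by
        rw [geomRep_mul_simple_self, geomRep_mul_simple, M.coroot_single_of_eq_three h']
        module
      rw [hrw]
      refine ih _ (by omega) (fun hd => ?_) rfl
      rw [isRightDescent_iff] at hd
      have hcomm : u * cs.simple i * cs.simple j * cs.simple i =
          u * cs.simple j * cs.simple i * cs.simple j := by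
        simpa only [mul_assoc] using congrArg (u * ·) (cs.simple_braid h')
      rw [hcomm] at hw
      have := cs.length_mul_simple (u * cs.simple j) i
      have := cs.length_mul_simple (u * cs.simple j * cs.simple i) j
      omega
    · exact add_nonneg (ih _ (by omega) hvi rfl) hvj'

theorem geomRep_single_nonpos {w : W} {i : I} (hw : cs.IsRightDescent w i) :
    cs.geomRep hsl w (Pi.single i 1) ≤ 0 := by
  have h := cs.geomRep_single_nonneg hsl (cs.isRightDescent_iff_not_isRightDescent_mul.1 hw)
  rwa [geomRep_mul_simple_self, Left.nonneg_neg_iff] at h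

theorem isRightDescent_iff_geomRep {w : W} {i : I} :
    cs.IsRightDescent w i ↔ cs.geomRep hsl w (Pi.single i 1) ≤ 0 := by
  refine ⟨cs.geomRep_single_nonpos hsl, fun h => ?_⟩
  by_contra hd
  exact cs.geomRep_single_ne_zero hsl w i (le_antisymm h (cs.geomRep_single_nonneg hsl hd))

theorem geomRep_eq_sum (w : W) (v : I → ℝ) :
    cs.geomRep hsl w v = ∑ i, v i • cs.geomRep hsl w (Pi.single i 1) := by
  conv_lhs => rw [pi_eq_sum_univ' v]
  simp [Pi.single]

theorem eq_of_forall_isRightDescent (hsl : M.IsSimplyLaced) {w w' : W}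
    (hw : ∀ i, cs.IsRightDescent w i) (hw' : ∀ i, cs.IsRightDescent w' i) : w = w' := by
  suffices h : w⁻¹ * w' = 1 from inv_mul_eq_one.1 h
  by_contra hne
  obtain ⟨i, hi⟩ := cs.exists_rightDescent_of_ne_one hne
  have h1 := cs.geomRep_single_nonpos hsl hi
  have h2 : cs.geomRep hsl w' (Pi.single i 1) =
      cs.geomRep hsl w (cs.geomRep hsl (w⁻¹ * w') (Pi.single i 1)) := by
    rw [← Module.End.mul_apply, ← map_mul, mul_inv_cancel_left]
  refine cs.geomRep_single_ne_zero hsl w' i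
    (le_antisymm (cs.geomRep_single_nonpos hsl (hw' i)) ?_)
  rw [h2, geomRep_eq_sum]
  exact Finset.sum_nonneg fun j _ => smul_nonneg_of_nonpos_of_nonpos (h1 j)
    (cs.geomRep_single_nonpos hsl (hw j))

theorem isRightDescent_mul_simple_iff (hsl : M.IsSimplyLaced) {w : W} {i j : I}
    (h : M i j = 2) : cs.IsRightDescent (w * cs.simple i) j ↔ cs.IsRightDescent w j := by
  rw [cs.isRightDescent_iff_geomRep hsl, cs.isRightDescent_iff_geomRep hsl, geomRep_mul_simple,
    M.coroot_single_of_eq_two h, zero_smul, sub_zero]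

theorem length_mul_wordProd_of_ascent (hsl : M.IsSimplyLaced) {w : W} {l : List I}
    (hl : l.Pairwise fun i j => M i j = 2) (hw : ∀ i ∈ l, ¬ cs.IsRightDescent w i) :
    cs.length (w * cs.wordProd l) = cs.length w + l.length := by
  induction l generalizing w with
  | nil => simp
  | cons i l ih =>
    rw [List.pairwise_cons] at hl
    rw [List.forall_mem_cons] at hw
    rw [wordProd_cons, ← mul_assoc, ih hl.2 fun j hj => by
      rw [cs.isRightDescent_mul_simple_iff hsl (hl.1 j hj)]
      exact hw.2 j hj, cs.not_isRightDescent_iff.1 hw.1, List.length_cons]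
    omega

theorem length_mul_wordProd_of_descent (hsl : M.IsSimplyLaced) {w : W} {l : List I}
    (hl : l.Pairwise fun i j => M i j = 2) (hw : ∀ i ∈ l, cs.IsRightDescent w i) :
    cs.length w = cs.length (w * cs.wordProd l) + l.length := by
  induction l generalizing w with
  | nil => simp
  | cons i l ih =>
    rw [List.pairwise_cons] at hl
    rw [List.forall_mem_cons] at hw
    rw [← cs.isRightDescent_iff.1 hw.1, wordProd_cons, ← mul_assoc, ih hl.2 fun j hj => by
      rw [cs.isRightDescent_mul_simple_iff hsl (hl.1 j hj)]
      exact hw.2 j hj, List.length_cons]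
    omega

theorem geomRep_mul_wordProd {w : W} {l : List I} (hl : l.Pairwise fun i j => M i j = 2)
    (v : I → ℝ) :
    cs.geomRep hsl (w * cs.wordProd l) v = cs.geomRep hsl w v -
      (l.map fun i => M.coroot i v • cs.geomRep hsl w (Pi.single i 1)).sum := by
  induction l generalizing w with
  | nil => simp
  | cons i l ih =>
    rw [List.pairwise_cons] at hl
    have hmap : (l.map fun j => M.coroot j v •
        cs.geomRep hsl (w * cs.simple i) (Pi.single j 1)) =
        l.map fun j => M.coroot j v • cs.geomRep hsl w (Pi.single j 1) :=
      List.map_congr_left fun j hj => by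
        rw [geomRep_mul_simple, M.coroot_single_of_eq_two (hl.1 j hj), zero_smul, sub_zero]
    rw [wordProd_cons, ← mul_assoc, ih hl.2, hmap, geomRep_mul_simple, List.map_cons,
      List.sum_cons]
    abel

/-- The linear functional `v ↦ a ⬝ᵥ v` pulled back along `w` is proportional to `a` on the
simple roots in `J`, and on those in `K`. -/
def IsUniform (a : I → ℝ) (J K : Finset I) (w : W) : Prop :=
  ∃ x y : ℝ, (∀ i ∈ J, a ⬝ᵥ cs.geomRep hsl w (Pi.single i 1) = x * a i) ∧
    ∀ i ∈ K, a ⬝ᵥ cs.geomRep hsl w (Pi.single i 1) = y * a i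

variable {cs hsl} {a : I → ℝ} {J K : Finset I} {w : W}

theorem IsUniform.symm (h : cs.IsUniform hsl a J K w) : cs.IsUniform hsl a K J w :=
  let ⟨x, y, hx, hy⟩ := h
  ⟨y, x, hy, hx⟩

theorem isUniform_one : cs.IsUniform hsl a J K 1 :=
  ⟨1, 1, by simp, by simp⟩

open Matrix in
theorem IsUniform.mul_wordProd (h : cs.IsUniform hsl a J K w) {μ : ℝ}
    (ha : M.adj *ᵥ a = μ • a) (hJK : Disjoint J K) (hcover : J ∪ K = Finset.univ)
    (hJ : ∀ i ∈ J, ∀ j ∈ J, i ≠ j → M i j = 2) (hK : ∀ i ∈ K, ∀ j ∈ K, i ≠ j → M i j = 2) :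
    cs.IsUniform hsl a J K (w * cs.wordProd J.toList) := by
  obtain ⟨x, y, hx, hy⟩ := h
  have key (k : I) : a ⬝ᵥ cs.geomRep hsl (w * cs.wordProd J.toList) (Pi.single k 1) =
      a ⬝ᵥ cs.geomRep hsl w (Pi.single k 1) -
        ∑ i ∈ J, M.coroot i (Pi.single k 1) * (x * a i) := by
    rw [cs.geomRep_mul_wordProd hsl (M.pairwise_toList hJ), Finset.sum_map_toList, dotProduct_sub,
      dotProduct_sum]
    congr 1
    refine Finset.sum_congr rfl fun i hi => ?_
    rw [dotProduct_smul, hx i hi, smul_eq_mul]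
  refine ⟨-x, y + μ * x, fun k hk => ?_, fun k hk => ?_⟩
  · rw [key, hx k hk, Finset.sum_eq_single_of_mem k hk fun i hi hik => by
      rw [M.coroot_single_of_eq_two (hJ i hi k hk hik), zero_mul], M.coroot_single_self]
    ring
  · have hkJ (i : I) (hi : i ∈ J) : M.coroot i (Pi.single k 1) = -M.adj k i := by
      have : i ≠ k := fun h => Finset.disjoint_left.1 hJK hi (h ▸ hk)
      rw [M.coroot_single, if_neg this, M.adj_symm]
      ring
    have hkK : ∑ i ∈ K, M.adj k i * a i = 0 := Finset.sum_eq_zero fun i hi => by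
      by_cases hik : k = i
      · rw [hik, M.adj_self, zero_mul]
      · simp [CoxeterMatrix.adj, hK k hk i hi hik]
    have hk' : ∑ i ∈ J, M.adj k i * a i = μ * a k := by
      rw [← smul_eq_mul, ← Pi.smul_apply, ← ha, mulVec, dotProduct, ← hcover,
        Finset.sum_union hJK, hkK, add_zero]
    rw [key, hy k hk, Finset.sum_congr rfl fun i hi => by
      rw [hkJ i hi, show -M.adj k i * (x * a i) = -x * (M.adj k i * a i) by ring],
      ← Finset.mul_sum, hk']
    ring

theorem IsUniform.isRightDescent (h : cs.IsUniform hsl a J K w) (ha : ∀ i, 0 < a i) :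
    (∀ i ∈ J, ¬ cs.IsRightDescent w i) ∨ ∀ i ∈ J, cs.IsRightDescent w i := by
  obtain ⟨x, -, hx, -⟩ := h
  rcases le_or_gt x 0 with hx0 | hx0
  · refine Or.inr fun i hi => ?_
    by_contra hd
    have h1 := dotProduct_pos_of_pos ha (cs.geomRep_single_nonneg hsl hd)
      (cs.geomRep_single_ne_zero hsl w i)
    rw [hx i hi] at h1
    exact h1.not_ge (mul_nonpos_of_nonpos_of_nonneg hx0 (ha i).le)
  · refine Or.inl fun i hi hd => ?_
    have h1 : a ⬝ᵥ cs.geomRep hsl w (Pi.single i 1) ≤ 0 := Finset.sum_nonpos fun j _ =>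
      mul_nonpos_of_nonneg_of_nonpos (ha j).le (cs.geomRep_single_nonpos hsl hd j)
    rw [hx i hi] at h1
    exact h1.not_gt (mul_pos hx0 (ha i))

theorem IsUniform.length_mul (h : cs.IsUniform hsl a J K w) (ha : ∀ i, 0 < a i)
    (hJ : ∀ i ∈ J, ∀ j ∈ J, i ≠ j → M i j = 2) :
    cs.length (w * cs.wordProd J.toList) = cs.length w + J.card ∨
      cs.length w = cs.length (w * cs.wordProd J.toList) + J.card := by
  rw [← Finset.length_toList]
  exact (h.isRightDescent ha).imp
    (fun hd => cs.length_mul_wordProd_of_ascent hsl (M.pairwise_toList hJ)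
      fun i hi => hd i (Finset.mem_toList.1 hi))
    (fun hd => cs.length_mul_wordProd_of_descent hsl (M.pairwise_toList hJ)
      fun i hi => hd i (Finset.mem_toList.1 hi))

theorem IsUniform.isRightDescent_of_length (h : cs.IsUniform hsl a J K w)
    (ha : ∀ i, 0 < a i) (hJ : ∀ i ∈ J, ∀ j ∈ J, i ≠ j → M i j = 2)
    (hlen : cs.length w = cs.length (w * cs.wordProd J.toList) + J.card) {i : I}
    (hi : i ∈ J) : cs.IsRightDescent w i := by
  refine (h.isRightDescent ha).elim (fun hd => ?_) fun hd => hd i hi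
  have h1 := cs.length_mul_wordProd_of_ascent hsl (M.pairwise_toList hJ)
    fun i hi => hd i (Finset.mem_toList.1 hi)
  have h2 := Finset.card_pos.2 ⟨i, hi⟩
  rw [Finset.length_toList] at h1
  omega

end CoxeterSystem

/-- Steinberg's theorem: in a finite irreducible simply-laced Weyl group with a 2-coloring
`I = I₀ ⊔ I₁` of the Dynkin diagram and bipartite Coxeter element `c₀c₁`, if the Coxeter
number `h` is even then `w₀ = (c₀c₁)^{h/2}` is a reduced expression for the longest element;
in particular `ℓ(w₀) = (h/2)·|I|`. -/
theorem statement6 {I : Type*} [DecidableEq I] [Fintype I] {W : Type*} [Group W] [Fintype W]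
    (M : CoxeterMatrix I) (cs : CoxeterSystem M W)
    (hsl : ∀ i j : I, i ≠ j → M i j = 2 ∨ M i j = 3)
    (hconn : ∀ s : Set I, s.Nonempty → (∀ i ∈ s, ∀ j, M i j = 3 → j ∈ s) → s = Set.univ)
    (I₀ I₁ : Finset I) (hdisj : Disjoint I₀ I₁) (hunion : I₀ ∪ I₁ = Finset.univ)
    (hcolor : ∀ i j : I, M i j = 3 →
      ¬(i ∈ I₀ ∧ j ∈ I₀) ∧ ¬(i ∈ I₁ ∧ j ∈ I₁))
    (c₀ c₁ : W)
    (hc₀ : ∀ l : List I, l.Nodup → l.toFinset = I₀ → (l.map cs.simple).prod = c₀)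
    (hc₁ : ∀ l : List I, l.Nodup → l.toFinset = I₁ → (l.map cs.simple).prod = c₁)
    (h : ℕ) (hh : h = orderOf (c₀ * c₁)) (hheven : Even h)
    (w₀ : W) (hw₀ : ∀ w : W, cs.length w ≤ cs.length w₀) :
    w₀ = (c₀ * c₁) ^ (h / 2) ∧ cs.length w₀ = (h / 2) * Fintype.card I := by
  have hM : M.IsSimplyLaced := hsl
  have hI₀ : ∀ i ∈ I₀, ∀ j ∈ I₀, i ≠ j → M i j = 2 := fun i hi j hj hij =>
    (hsl i j hij).resolve_right fun h3 => (hcolor i j h3).1 ⟨hi, hj⟩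
  have hI₁ : ∀ i ∈ I₁, ∀ j ∈ I₁, i ≠ j → M i j = 2 := fun i hi j hj hij =>
    (hsl i j hij).resolve_right fun h3 => (hcolor i j h3).2 ⟨hi, hj⟩
  obtain ⟨a, μ, ha, hμ⟩ := M.adj.exists_pos_eigenvector M.adj_symm
    (fun i j => by unfold CoxeterMatrix.adj; split_ifs <;> norm_num)
    (fun s hs hadj => hconn s hs fun i hi j hij => hadj i hi j (by simp [CoxeterMatrix.adj, hij]))
  have sq_eq_one {J : Finset I} {c : W}
      (hc : ∀ l : List I, l.Nodup → l.toFinset = J → (l.map cs.simple).prod = c) :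
      c * c = 1 := by
    have h1 := cs.wordProd_reverse J.toList
    rw [CoxeterSystem.wordProd, CoxeterSystem.wordProd, hc _ J.nodup_toList J.toList_toFinset,
      hc _ (List.nodup_reverse.2 J.nodup_toList) (by simp)] at h1
    exact mul_eq_one_iff_eq_inv.2 h1
  have hsq₀ := sq_eq_one hc₀
  have hsq₁ := sq_eq_one hc₁
  have hprod₀ : cs.wordProd I₀.toList = c₀ := hc₀ _ I₀.nodup_toList I₀.toList_toFinset
  have hprod₁ : cs.wordProd I₁.toList = c₁ := hc₁ _ I₁.nodup_toList I₁.toList_toFinset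
  have hunion' : I₁ ∪ I₀ = Finset.univ := by rw [Finset.union_comm, hunion]
  have hd₀ := cs.isRightDescent_of_forall_length_le hw₀
  have H : IsAltLength cs.length (cs.IsUniform hM a I₀ I₁) c₀ c₁ w₀ I₀.card I₁.card :=
    { len_eq_zero := cs.length_eq_zero_iff
      one := CoxeterSystem.isUniform_one
      mul_left := fun hw => hprod₀ ▸ hw.mul_wordProd hμ hdisj hunion hI₀ hI₁
      mul_right := fun hw =>
        hprod₁ ▸ (hw.symm.mul_wordProd hμ hdisj.symm hunion' hI₁ hI₀).symm
      left_sq := hsq₀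
      right_sq := hsq₁
      len_left := fun hw => hprod₀ ▸ hw.length_mul ha hI₀
      len_right := fun hw => hprod₁ ▸ hw.symm.length_mul ha hI₁
      eq_longest := fun hw h₀ h₁ => by
        subst hprod₀ hprod₁
        refine cs.eq_of_forall_isRightDescent hM (fun i => ?_) hd₀
        have hi : i ∈ I₀ ∪ I₁ := hunion ▸ Finset.mem_univ i
        rcases Finset.mem_union.1 hi with hi | hi
        exacts [hw.isRightDescent_of_length ha hI₀ h₀ hi,
          hw.symm.isRightDescent_of_length ha hI₁ h₁ hi]
      le_longest := hw₀
      longest_sq := mul_eq_one_iff_eq_inv.2 <| cs.eq_of_forall_isRightDescent hM hd₀ <|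
        cs.isRightDescent_of_forall_length_le fun w => by rw [cs.length_inv]; exact hw₀ w }
  rw [hh] at hheven ⊢
  rw [← Finset.card_univ, ← hunion, Finset.card_union_of_disjoint hdisj]
  exact H.longest_eq_pow hheven
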